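/- As $x \to \infty$, $-4x \int_1^{x^{1/3}} \frac{\{t\}}{t^{3/2}\sqrt{t^3 + 8x}}\, dt = 2\sqrt{2}\left(1 + \zeta\left(\frac{1}{2}\right)\right)\sqrt{x} + O(x^{1/3})$, where $\zeta$ denotes the Riemann zeta function (analytically continued, so $\zeta(1/2)$ is its value at $1/2$). -/

import Mathlib

open Filter Asymptotics

open MeasureTheory Set in
noncomputable def auxF : ℝ → ℂ := Set.indicator (Ioi 1) (fun t => ((Int.fract t : ℝ) : ℂ))

open MeasureTheory Set Topology

lemma auxF_meas : Measurable auxF := by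
  unfold auxF
  exact (Complex.measurable_ofReal.comp measurable_fract).indicator measurableSet_Ioi

lemma auxF_norm (t : ℝ) : ‖auxF t‖ ≤ 1 := by
  unfold auxF
  refine (norm_indicator_le_norm_self _ _).trans ?_
  rw [Complex.norm_real, Real.norm_of_nonneg (Int.fract_nonneg t)]
  exact (Int.fract_lt_one t).le

lemma auxF_loc : LocallyIntegrableOn auxF (Ioi 0) := by
  refine LocallyIntegrable.locallyIntegrableOn ?_ _
  refine (locallyIntegrable_const (1:ℝ)).mono auxF_meas.aestronglyMeasurable ?_
  filter_upwards with t
  simpa using auxF_norm t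

lemma auxF_top : auxF =O[atTop] (fun t : ℝ => t ^ (-(0:ℝ))) := by
  refine IsBigO.of_bound 1 (Eventually.of_forall fun t => ?_)
  simpa using auxF_norm t

lemma auxF_bot (b : ℝ) : auxF =O[𝓝[>] 0] (fun t : ℝ => t ^ (-b)) := by
  have : auxF =ᶠ[𝓝[>] 0] 0 := by
    refine Filter.Eventually.filter_mono nhdsWithin_le_nhds ?_
    filter_upwards [Iio_mem_nhds (zero_lt_one (α := ℝ))] with t ht
    have : t < 1 := ht
    simp [auxF, this.le]
  exact this.trans_isBigO (isBigO_zero _ _)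

lemma auxF_diff {s : ℂ} (hs : 0 < s.re) : DifferentiableAt ℂ (mellin auxF) (-s) :=
  mellin_differentiableAt_of_isBigO_rpow (b := -s.re - 1) auxF_loc auxF_top (by simpa using hs)
    (auxF_bot _) (by simp)

lemma mellin_auxF (s : ℂ) : mellin auxF (-s) = ∫ t in Ioi (1:ℝ), (t:ℂ) ^ (-(s+1)) * ((Int.fract t : ℝ) : ℂ) := by
  unfold mellin auxF
  have : ∀ t : ℝ, (t:ℂ) ^ (-s - 1) • (Ioi (1:ℝ)).indicator (fun t => ((Int.fract t : ℝ) : ℂ)) t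
     = (Ioi (1:ℝ)).indicator (fun t : ℝ => (t:ℂ) ^ (-(s+1)) * ((Int.fract t : ℝ) : ℂ)) t := by
    intro t
    by_cases h : t ∈ Ioi (1:ℝ)
    · simp only [indicator_of_mem h, smul_eq_mul]
      congr 2; ring
    · simp only [indicator_of_notMem h, smul_zero]
  simp_rw [this]
  rw [setIntegral_indicator measurableSet_Ioi,
    inter_eq_right.mpr (Ioi_subset_Ioi zero_le_one)]

lemma integrable_frac {s : ℂ} (hs : 0 < s.re) :
    IntegrableOn (fun t : ℝ => (t:ℂ) ^ (-(s+1)) * ((Int.fract t : ℝ) : ℂ)) (Ioi 1) := by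
  have h : IntegrableOn (fun t : ℝ => (t:ℂ) ^ (-(s+1))) (Ioi 1) :=
    integrableOn_Ioi_cpow_of_lt (by simp; linarith) one_pos
  refine Integrable.mul_bdd h (c := 1) ?_ ?_
  · exact (Complex.measurable_ofReal.comp measurable_fract).aestronglyMeasurable
  · filter_upwards with t
    rw [Complex.norm_real, Real.norm_of_nonneg (Int.fract_nonneg t)]
    exact (Int.fract_lt_one t).le

lemma zeta_gt_one {s : ℂ} (hs : 1 < s.re) :
    (s - 1) * riemannZeta s = s - s * (s - 1) * mellin auxF (-s) := by
  have h1 := LSeries_eq_mul_integral_of_nonneg (fun _ => (1:ℝ)) (r := 1) zero_le_one hs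
    (by simpa using isBigO_refl _ _) (fun _ => zero_le_one)
  have hs1 : s - 1 ≠ 0 := by
    intro h; rw [sub_eq_zero] at h; simp [h] at hs
  have h2 : LSeries (fun n ↦ (((fun _ => (1:ℝ)) n : ℝ) : ℂ)) s = riemannZeta s := by
    rw [← LSeries_one_eq_riemannZeta hs]
    congr 1
  rw [h2] at h1
  have h3 : ∫ t in Ioi (1:ℝ), (t:ℂ) ^ (-s) = 1 / (s - 1) := by
    rw [integral_Ioi_cpow_of_lt (by simpa using hs) one_pos]
    have : -s + 1 ≠ 0 := by contrapose! hs1; linear_combination -hs1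
    simp; field_simp; ring
  have h4 : (∫ t in Ioi (1 : ℝ), (∑ k ∈ Finset.Icc 1 ⌊t⌋₊, (((fun _ => (1:ℝ)) k : ℝ) : ℂ)) * (t:ℂ) ^ (-(s + 1)))
     = 1 / (s - 1) - mellin auxF (-s) := by
    rw [← h3, mellin_auxF, ← integral_sub (integrableOn_Ioi_cpow_of_lt (by simpa using hs) one_pos)
      (integrable_frac (by linarith))]
    refine setIntegral_congr_fun measurableSet_Ioi fun t ht => ?_
    have ht : (1:ℝ) < t := ht
    have ht0 : (t:ℂ) ≠ 0 := by exact_mod_cast (by linarith : t ≠ 0)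
    have e1 : ((⌊t⌋₊ : ℕ) : ℂ) = (t:ℂ) - ((Int.fract t : ℝ) : ℂ) := by
      have : ((⌊t⌋₊ : ℕ) : ℝ) = t - Int.fract t := by
        rw [natCast_floor_eq_intCast_floor (by linarith), Int.self_sub_fract]
      rw [← Complex.ofReal_sub, ← this]; simp
    have e2 : (t:ℂ) ^ (-s) = t * (t:ℂ) ^ (-(s+1)) := by
      have := Complex.cpow_add 1 (-(s+1)) ht0
      rw [Complex.cpow_one] at this
      rw [← this]; congr 1; ring
    simp only [Complex.ofReal_one, Finset.sum_const, Nat.card_Icc, add_tsub_cancel_right, nsmul_eq_mul, mul_one]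
    rw [e1, e2]; ring
  rw [h1, h4]; field_simp

lemma zeta_re_pos {s : ℂ} (hs : 0 < s.re) :
    riemannZeta₁ s = s - s * (s - 1) * mellin auxF (-s) := by
  have hU : IsOpen {s : ℂ | 0 < s.re} := isOpen_lt continuous_const Complex.continuous_re
  have A : AnalyticOnNhd ℂ riemannZeta₁ {s : ℂ | 0 < s.re} :=
    differentiable_riemannZeta₁.differentiableOn.analyticOnNhd hU
  have B : AnalyticOnNhd ℂ (fun s => s - s * (s - 1) * mellin auxF (-s)) {s : ℂ | 0 < s.re} := by
    refine DifferentiableOn.analyticOnNhd (fun z hz => DifferentiableAt.differentiableWithinAt ?_) hU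
    have : DifferentiableAt ℂ (fun z => mellin auxF (-z)) z :=
      DifferentiableAt.comp (g := mellin auxF) z (auxF_diff hz) differentiableAt_id.neg
    fun_prop
  refine A.eqOn_of_preconnected_of_eventuallyEq B (convex_halfSpace_re_gt 0).isPreconnected
    (z₀ := 2) (by simp) ?_ hs
  have : {s : ℂ | 1 < s.re} ∈ 𝓝 (2:ℂ) :=
    (isOpen_lt continuous_const Complex.continuous_re).mem_nhds (by simp)
  filter_upwards [this] with z hz
  have hz : 1 < z.re := hz
  have hz1 : z ≠ 1 := by rintro rfl; simp at hz
  rw [← zeta_gt_one hz, riemannZeta_eq_inv_sub_mul hz1]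
  have := sub_ne_zero.mpr hz1
  field_simp

noncomputable def auxJ : ℝ := ∫ t in Ioi (1:ℝ), Int.fract t * t ^ (-(3/2:ℝ))

lemma zeta_half : 1 + riemannZeta (1/2) = -(auxJ / 2 : ℂ) := by
  have h := zeta_re_pos (s := 1/2) (by norm_num)
  have h2 := riemannZeta_eq_inv_sub_mul (s := 1/2) (by norm_num)
  have h3 : mellin auxF (-(1/2)) = auxJ := by
    rw [mellin_auxF, auxJ, ← integral_complex_ofReal]
    refine setIntegral_congr_fun measurableSet_Ioi fun t ht => ?_
    have ht : (1:ℝ) < t := ht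
    rw [Complex.ofReal_mul, Complex.ofReal_cpow (by linarith), mul_comm]
    congr 2; push_cast; ring
  rw [h2, h, h3]; ring

lemma J_int : IntegrableOn (fun t : ℝ => Int.fract t * t ^ (-(3/2:ℝ))) (Ioi 1) := by
  have h : IntegrableOn (fun t : ℝ => t ^ (-(3/2:ℝ))) (Ioi 1) :=
    integrableOn_Ioi_rpow_of_lt (by norm_num) one_pos
  refine Integrable.bdd_mul h (c := 1) measurable_fract.aestronglyMeasurable ?_
  filter_upwards with t
  rw [Real.norm_of_nonneg (Int.fract_nonneg t)]
  exact (Int.fract_lt_one t).le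

lemma q_bound {a b : ℝ} (ha : 0 ≤ a) (hb : 0 < b) : 
    0 ≤ 1 - √b / √(a + b) ∧ 1 - √b / √(a + b) ≤ a / b := by
  rw [← Real.sqrt_div hb.le]
  have h0 : 0 < a + b := by linarith
  have h1 : b / (a + b) ≤ 1 := by rw [div_le_one h0]; linarith
  have h2 : √(b / (a+b)) ≤ 1 := by rw [Real.sqrt_le_one]; exact h1
  have h3 : b / (a+b) ≤ √(b / (a+b)) := by
    apply Real.le_sqrt_of_sq_le
    have : 0 ≤ b / (a+b) := by positivity
    nlinarith
  refine ⟨by linarith, ?_⟩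
  have : 1 - a / b ≤ b / (a+b) := by
    rw [le_div_iff₀ h0]
    have : (1 - a/b) * (a+b) = b - a * a / b := by field_simp; ring
    rw [this]
    have : 0 ≤ a * a / b := by positivity
    linarith
  linarith

lemma main_bound {y : ℝ} (hy : 1 ≤ y) :
    |(-4 * y^6 * ∫ t in (1 : ℝ)..y^2,
            Int.fract t / (t ^ ((3 : ℝ) / 2) * Real.sqrt (t ^ 3 + 8 * y^6))) + √2 * y^3 * auxJ|
      ≤ 5 * y^2 := by
  have hy0 : 0 < y := by linarith
  have hy2 : 1 ≤ y^2 := one_le_pow₀ hy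
  have hs2 : √2 ≤ 2 := by rw [Real.sqrt_le_left (by norm_num)]; norm_num
  have hs20 : 0 ≤ √2 := Real.sqrt_nonneg 2
  have hmul : √2 * √(8 * y^6) = 4 * y^3 := by
    rw [← Real.sqrt_mul (by norm_num), show 2 * (8 * y^6) = (4 * y^3)^2 by ring,
      Real.sqrt_sq (by positivity)]
  have hsplit : auxJ = (∫ t in (1:ℝ)..y^2, Int.fract t * t ^ (-(3/2:ℝ)))
      + ∫ t in Ioi (y^2), Int.fract t * t ^ (-(3/2:ℝ)) := by
    rw [auxJ, intervalIntegral.integral_interval_add_Ioi J_int (J_int.mono_set (Ioi_subset_Ioi hy2))]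
  set T := ∫ t in Ioi (y^2), Int.fract t * t ^ (-(3/2:ℝ)) with hT
  have hT1 : |T| ≤ 2 / y := by
    have : ∫ t in Ioi (y^2), t ^ (-(3/2:ℝ)) = 2 / y := by
      rw [integral_Ioi_rpow_of_lt (by norm_num) (by positivity)]
      have : (y^2) ^ (-(3/2:ℝ) + 1) = y⁻¹ := by
        rw [← Real.rpow_natCast, ← Real.rpow_mul hy0.le, ← Real.rpow_neg_one]; norm_num
      rw [this]; field_simp; norm_num
    rw [← this, ← Real.norm_eq_abs, hT]
    refine norm_integral_le_of_norm_le (integrableOn_Ioi_rpow_of_lt (by norm_num) (by positivity)) ?_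
    rw [ae_restrict_iff' measurableSet_Ioi]
    filter_upwards with t ht
    have ht : y^2 < t := ht
    have ht0 : 0 < t := by linarith
    have := Int.fract_nonneg t
    have := (Int.fract_lt_one t).le
    have hp : 0 ≤ t ^ (-(3/2:ℝ)) := by positivity
    rw [Real.norm_of_nonneg (by positivity)]
    nlinarith
  have hI1 : IntervalIntegrable (fun t => Int.fract t * t ^ (-(3/2:ℝ))) volume 1 (y^2) := by
    rw [intervalIntegrable_iff_integrableOn_Ioc_of_le hy2]
    exact J_int.mono_set Ioc_subset_Ioi_self
  have hq : ∀ t : ℝ, 1 < t → -4 * y^6 * (Int.fract t / (t ^ ((3 : ℝ) / 2) * √(t ^ 3 + 8 * y^6)))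
      = - (√2 * y^3) * ((Int.fract t * t ^ (-(3/2:ℝ))) * (√(8*y^6) / √(t ^ 3 + 8 * y^6))) := by
    intro t ht
    have ht0 : 0 < t := by linarith
    rw [Real.rpow_neg ht0.le]
    have : 0 < √(t ^ 3 + 8 * y^6) := by positivity
    have : 0 < t ^ (3/2:ℝ) := by positivity
    rw [mul_comm 8 (y^6)] at hmul ⊢
    field_simp
    linear_combination (Int.fract t) * hmul
  have hI2 : IntervalIntegrable (fun t => (Int.fract t * t ^ (-(3/2:ℝ))) * (√(8*y^6) / √(t ^ 3 + 8 * y^6))) volume 1 (y^2) := by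
    refine hI1.mul_continuousOn ?_
    refine ContinuousOn.div (by fun_prop) (by fun_prop) ?_
    intro t ht
    rw [uIcc_of_le hy2] at ht
    have : 0 < t := by linarith [ht.1]
    positivity
  have hD : (-4 * y^6 * ∫ t in (1 : ℝ)..y^2,
            Int.fract t / (t ^ ((3 : ℝ) / 2) * Real.sqrt (t ^ 3 + 8 * y^6))) + √2 * y^3 * auxJ
      = √2 * y^3 * (∫ t in (1:ℝ)..y^2, (Int.fract t * t ^ (-(3/2:ℝ)) -
         (Int.fract t * t ^ (-(3/2:ℝ))) * (√(8*y^6) / √(t ^ 3 + 8 * y^6)))) + √2 * y^3 * T := by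
    rw [intervalIntegral.integral_sub hI1 hI2, hsplit, ← intervalIntegral.integral_const_mul]
    have : ∫ t in (1 : ℝ)..y^2, -4 * y^6 * (Int.fract t / (t ^ ((3 : ℝ) / 2) * √(t ^ 3 + 8 * y^6)))
       = ∫ t in (1 : ℝ)..y^2, - (√2 * y^3) * ((Int.fract t * t ^ (-(3/2:ℝ))) * (√(8*y^6) / √(t ^ 3 + 8 * y^6))) := by
      refine intervalIntegral.integral_congr_ae ?_
      filter_upwards with t ht
      rw [uIoc_of_le hy2] at ht
      exact hq t ht.1
    rw [this, intervalIntegral.integral_const_mul]; ring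
  have hE : |∫ t in (1:ℝ)..y^2, (Int.fract t * t ^ (-(3/2:ℝ)) -
         (Int.fract t * t ^ (-(3/2:ℝ))) * (√(8*y^6) / √(t ^ 3 + 8 * y^6)))| ≤ 1 / (8 * y) := by
    have := intervalIntegral.norm_integral_le_of_norm_le_const (a := 1) (b := y^2) (C := 1 / (8 * y^3))
      (f := fun t => (Int.fract t * t ^ (-(3/2:ℝ)) -
         (Int.fract t * t ^ (-(3/2:ℝ))) * (√(8*y^6) / √(t ^ 3 + 8 * y^6)))) ?_
    · rw [Real.norm_eq_abs] at this
      refine this.trans ?_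
      rw [abs_of_nonneg (by linarith)]
      calc 1 / (8 * y^3) * (y^2 - 1) ≤ 1 / (8 * y^3) * y^2 := by gcongr; linarith
        _ = _ := by field_simp
    · intro t ht
      rw [uIoc_of_le hy2] at ht
      have ht0 : 0 < t := by linarith [ht.1]
      obtain ⟨q1, q2⟩ := q_bound (a := t^3) (b := 8*y^6) (by positivity) (by positivity)
      have f1 := Int.fract_nonneg t
      have f2 := (Int.fract_lt_one t).le
      have hp : 0 ≤ t ^ (-(3/2:ℝ)) := by positivity
      rw [← mul_one_sub, Real.norm_of_nonneg (by positivity)]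
      have e : t ^ (-(3/2:ℝ)) * t^3 = t ^ (3/2:ℝ) := by
        rw [← Real.rpow_natCast, ← Real.rpow_add ht0]; norm_num
      have e2 : t ^ (3/2:ℝ) ≤ y^3 := by
        calc t ^ (3/2:ℝ) ≤ (y^2) ^ (3/2:ℝ) := by gcongr; exact ht.2
          _ = y^3 := by
            rw [← Real.rpow_natCast, ← Real.rpow_mul hy0.le, ← Real.rpow_natCast]; norm_num
      calc _ ≤ (1 * t ^ (-(3/2:ℝ))) * (t^3 / (8*y^6)) := by gcongr
        _ = t ^ (3/2:ℝ) / (8 * y^6) := by rw [← e]; ring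
        _ ≤ y^3 / (8*y^6) := by gcongr
        _ = _ := by field_simp
  rw [hD]
  refine (abs_add_le _ _).trans ?_
  rw [abs_mul (√2 * y^3), abs_mul (√2 * y^3), abs_of_nonneg (by positivity : 0 ≤ √2 * y^3)]
  calc _ ≤ 2 * y^3 * (1 / (8*y)) + 2 * y^3 * (2 / y) := by gcongr
    _ = (17/4) * y^2 := by field_simp; ring
    _ ≤ _ := by nlinarith

theorem fract_integral_second_asymptotic :
    (fun x : ℝ =>
        ((-4 * x * ∫ t in (1 : ℝ)..x ^ ((1 : ℝ) / 3),
            Int.fract t / (t ^ ((3 : ℝ) / 2) * Real.sqrt (t ^ 3 + 8 * x)) : ℝ) : ℂ)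
          - 2 * Real.sqrt 2 * (1 + riemannZeta (1 / 2)) * (Real.sqrt x : ℂ))
      =O[atTop] fun x : ℝ => x ^ ((1 : ℝ) / 3) := by
  refine IsBigO.of_bound 5 ?_
  filter_upwards [eventually_ge_atTop 1] with x hx
  obtain ⟨y, hy, rfl⟩ : ∃ y : ℝ, 1 ≤ y ∧ x = y^6 := by
    refine ⟨x ^ (1/6:ℝ), Real.one_le_rpow hx (by norm_num), ?_⟩
    rw [← Real.rpow_natCast, ← Real.rpow_mul (by linarith)]; norm_num
  have hy0 : 0 ≤ y := by linarith
  have h1 : (y^6) ^ ((1:ℝ)/3) = y^2 := by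
    rw [← Real.rpow_natCast, ← Real.rpow_mul hy0, ← Real.rpow_natCast]; norm_num
  have h2 : √(y^6) = y^3 := by
    rw [show y^6 = (y^3)^2 by ring, Real.sqrt_sq (by positivity)]
  rw [h1, h2, zeta_half, Real.norm_of_nonneg (by positivity : 0 ≤ y^2)]
  refine le_trans (le_of_eq ?_) (main_bound hy)
  rw [← Real.norm_eq_abs, ← Complex.norm_real]
  congr 1
  push_cast
  ring
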